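/- Let (X, μ) be a measure space with 0 < μ(X) < ∞, let m > 1 be real, and let ω : X → ℝ be measurable with ∫_X |ω|^{2(m+1)} dμ < ∞ and with ω not equal to 0 μ-almost everywhere. For real s ≥ 1 set Ω_s = ((1/μ(X)) ∫_X |ω|^{2s} dμ)^{1/(2s)}, and for ϖ₀ > 0 define D_s = (Ω_s/ϖ₀)^{α_s} with α_s = 2s/(4s−3), so D_1 = (Ω_1/ϖ₀)². Then D_m/D_1 ≤ (D_{m+1}/D_m)^{(m−1)(4m+1)}. -/

import Mathlib

open MeasureTheory ENNReal

section PowerMoments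

variable {X : Type*} [MeasurableSpace X] {μ : Measure X} {f : X → ℝ}

/-- Log-convexity of the power moments `p ↦ ∫ |f| ^ p`. -/
theorem lintegral_abs_rpow_le_interpolate (hf : Measurable f) {p q a b : ℝ}
    (hp : 0 < p) (hq : 0 < q) (ha : 0 ≤ a) (hb : 0 ≤ b) (hab : a + b = 1) :
    ∫⁻ x, ENNReal.ofReal (|f x| ^ (a * p + b * q)) ∂μ ≤
      (∫⁻ x, ENNReal.ofReal (|f x| ^ p) ∂μ) ^ a *
        (∫⁻ x, ENNReal.ofReal (|f x| ^ q) ∂μ) ^ b := by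
  have hm : ∀ r : ℝ, AEMeasurable (fun x => ENNReal.ofReal (|f x| ^ r)) μ := fun r => by
    fun_prop
  refine le_trans (lintegral_mono fun x => ?_)
    (ENNReal.lintegral_mul_norm_pow_le (hm p) (hm q) ha hb hab)
  have h0 := abs_nonneg (f x)
  rw [ENNReal.ofReal_rpow_of_nonneg (by positivity) ha,
    ENNReal.ofReal_rpow_of_nonneg (by positivity) hb,
    ← ENNReal.ofReal_mul (by positivity), ← Real.rpow_mul h0, ← Real.rpow_mul h0,
    Real.rpow_add_of_nonneg h0 (by positivity) (by positivity), mul_comm a, mul_comm b]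

theorem lintegral_abs_rpow_lt_top_of_le [IsFiniteMeasure μ] {p q : ℝ} (hp : 0 ≤ p) (hpq : p ≤ q)
    (hq : ∫⁻ x, ENNReal.ofReal (|f x| ^ q) ∂μ < ⊤) :
    ∫⁻ x, ENNReal.ofReal (|f x| ^ p) ∂μ < ⊤ := by
  have hle : ∀ x, ENNReal.ofReal (|f x| ^ p) ≤ 1 + ENNReal.ofReal (|f x| ^ q) := fun x => by
    rcases le_total |f x| 1 with h | h
    · exact (ENNReal.ofReal_le_one.2 (Real.rpow_le_one (abs_nonneg _) h hp)).trans le_self_add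
    · exact (ENNReal.ofReal_le_ofReal (Real.rpow_le_rpow_of_exponent_le h hpq)).trans le_add_self
  refine (lintegral_mono hle).trans_lt ?_
  rw [lintegral_add_left measurable_const, lintegral_one]
  exact ENNReal.add_lt_top.2 ⟨measure_lt_top μ _, hq⟩

theorem lintegral_abs_rpow_pos (hf : Measurable f) (hne : ¬ f =ᵐ[μ] 0) {p : ℝ} :
    0 < ∫⁻ x, ENNReal.ofReal (|f x| ^ p) ∂μ := by
  refine pos_iff_ne_zero.2 fun h => hne ?_
  rw [lintegral_eq_zero_iff (by fun_prop)] at h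
  filter_upwards [h] with x hx
  by_contra hx0
  have : 0 < |f x| ^ p := Real.rpow_pos_of_pos (abs_pos.2 hx0) p
  exact absurd (ENNReal.ofReal_eq_zero.1 hx) (not_le.2 this)

/-- Log-convexity of the power moments, in logarithmic form and with normalized measure. -/
theorem log_moment_le_interpolate (hμ0 : 0 < μ Set.univ) (hμfin : μ Set.univ < ⊤)
    (hf : Measurable f) {p q a b : ℝ}
    (hp : 0 < p) (hq : 0 < q) (ha : 0 ≤ a) (hb : 0 ≤ b) (hab : a + b = 1)
    (hne : ¬ f =ᵐ[μ] 0) (hpfin : ∫⁻ x, ENNReal.ofReal (|f x| ^ p) ∂μ < ⊤)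
    (hqfin : ∫⁻ x, ENNReal.ofReal (|f x| ^ q) ∂μ < ⊤) :
    Real.log ((∫⁻ x, ENNReal.ofReal (|f x| ^ (a * p + b * q)) ∂μ) / μ Set.univ).toReal ≤
      a * Real.log ((∫⁻ x, ENNReal.ofReal (|f x| ^ p) ∂μ) / μ Set.univ).toReal +
        b * Real.log ((∫⁻ x, ENNReal.ofReal (|f x| ^ q) ∂μ) / μ Set.univ).toReal := by
  have h := lintegral_abs_rpow_le_interpolate (μ := μ) hf hp hq ha hb hab
  have hP := ENNReal.toReal_pos (lintegral_abs_rpow_pos (p := p) hf hne).ne' hpfin.ne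
  have hQ := ENNReal.toReal_pos (lintegral_abs_rpow_pos (p := q) hf hne).ne' hqfin.ne
  have htop := ENNReal.mul_lt_top (ENNReal.rpow_lt_top_of_nonneg ha hpfin.ne)
    (ENNReal.rpow_lt_top_of_nonneg hb hqfin.ne)
  have hR := ENNReal.toReal_pos
    (lintegral_abs_rpow_pos (p := a * p + b * q) hf hne).ne' (h.trans_lt htop).ne
  have hM := ENNReal.toReal_pos hμ0.ne' hμfin.ne
  have h' := Real.log_le_log hR (ENNReal.toReal_mono htop.ne h)
  rw [ENNReal.toReal_mul, ← ENNReal.toReal_rpow, ← ENNReal.toReal_rpow,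
    Real.log_mul (by positivity) (by positivity), Real.log_rpow hP, Real.log_rpow hQ] at h'
  simp only [ENNReal.toReal_div]
  rw [Real.log_div hR.ne' hM.ne', Real.log_div hP.ne' hM.ne', Real.log_div hQ.ne' hM.ne']
  obtain rfl : b = 1 - a := by linarith
  linarith

end PowerMoments

/-- Inequality (s4): `D_m/D₁ ≤ (D_{m+1}/D_m)^{(m-1)(4m+1)}` for the dimensionless vorticity
moments `D_s = (Ω_s/ϖ₀)^{α_s}`, `α_s = 2s/(4s-3)`, with
`Ω_s = ((1/μ(X)) ∫ |ω|^{2s} dμ)^{1/(2s)}` and `ω` not μ-a.e. zero. -/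
theorem stmt_4 {X : Type*} [MeasurableSpace X] (μ : Measure X)
    (hμ0 : 0 < μ Set.univ) (hμfin : μ Set.univ < ⊤)
    (m : ℝ) (hm : 1 < m)
    (ω : X → ℝ) (hω : Measurable ω)
    (hfin : (∫⁻ x, ENNReal.ofReal (|ω x| ^ (2 * (m + 1))) ∂μ) < ⊤)
    (hωne : ¬ (ω =ᵐ[μ] 0))
    (ϖ₀ : ℝ) (hϖ₀ : 0 < ϖ₀)
    (Ω : ℝ → ℝ)
    (hΩ : ∀ s : ℝ, Ω s =
      (((∫⁻ x, ENNReal.ofReal (|ω x| ^ (2 * s)) ∂μ) / μ Set.univ).toReal) ^ (1 / (2 * s)))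
    (α D : ℝ → ℝ)
    (hα : ∀ s : ℝ, α s = 2 * s / (4 * s - 3))
    (hD : ∀ s : ℝ, D s = (Ω s / ϖ₀) ^ α s) :
    D m / D 1 ≤ (D (m + 1) / D m) ^ ((m - 1) * (4 * m + 1)) := by
  have : IsFiniteMeasure μ := ⟨hμfin⟩
  have hm0 : 0 < m := by linarith
  have hJ : ∀ s, 0 ≤ s → s ≤ m + 1 →
      0 < ((∫⁻ x, ENNReal.ofReal (|ω x| ^ (2 * s)) ∂μ) / μ Set.univ).toReal := fun s hs hsm =>
    ENNReal.toReal_pos (ENNReal.div_pos (lintegral_abs_rpow_pos hω hωne).ne' hμfin.ne).ne'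
      (ENNReal.div_lt_top
        (lintegral_abs_rpow_lt_top_of_le (by linarith) (by linarith) hfin).ne hμ0.ne').ne
  have hDpos : ∀ s, 0 ≤ s → s ≤ m + 1 → 0 < D s := fun s hs hsm => by
    rw [hD, hΩ]
    have := hJ s hs hsm
    positivity
  have hlogJ : ∀ s, 1 ≤ s → s ≤ m + 1 →
      Real.log ((∫⁻ x, ENNReal.ofReal (|ω x| ^ (2 * s)) ∂μ) / μ Set.univ).toReal =
        (4 * s - 3) * Real.log (D s) + 2 * s * Real.log ϖ₀ := fun s hs hsm => by
    have hpos := hJ s (by linarith) hsm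
    have h43 : 4 * s - 3 ≠ 0 := by linarith
    have hs0 : s ≠ 0 := by linarith
    rw [hD, hΩ, hα, Real.log_rpow (by positivity), Real.log_div (by positivity) hϖ₀.ne',
      Real.log_rpow hpos, ← mul_assoc, mul_div_cancel₀ _ h43]
    field_simp
    ring
  have hint := log_moment_le_interpolate (μ := μ) (p := 2 * 1) (q := 2 * (m + 1)) (a := 1 / m)
    (b := (m - 1) / m) hμ0 hμfin hω (by norm_num) (by linarith) (by positivity)
    (div_nonneg (by linarith) hm0.le) (by field_simp; ring) hωne
    (lintegral_abs_rpow_lt_top_of_le (by norm_num) (by linarith) hfin) hfin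
  rw [show 1 / m * (2 * 1) + (m - 1) / m * (2 * (m + 1)) = 2 * m by field_simp; ring,
    hlogJ 1 le_rfl (by linarith), hlogJ m hm.le (by linarith),
    hlogJ (m + 1) (by linarith) le_rfl] at hint
  have hscaled := mul_le_mul_of_nonneg_left hint hm0.le
  field_simp at hscaled
  have h1 := hDpos 1 (by norm_num) (by linarith)
  have h2 := hDpos m hm0.le (by linarith)
  have h3 := hDpos (m + 1) (by linarith) le_rfl
  rw [← Real.log_le_log_iff (by positivity) (by positivity), Real.log_rpow (by positivity),
    Real.log_div h2.ne' h1.ne', Real.log_div h3.ne' h2.ne']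
  linarith
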